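/- Let 𝒥 be the ideal of H*(GQ_{2n−1}) generated by the elements M_i − Q for 1 ≤ i ≤ n. (a) If K and H are independent subsets of V with |K| = |H| = n, then Δ_K − Δ_H ∈ 𝒥. (b) If K is independent with |K| = n and L is a nonempty independent subset with |L| = n − l for some 1 ≤ l ≤ n−1, then Δ_L − Δ_K·Q^l ∈ 𝒥. -/

import Mathlib

open MvPolynomial Finset

noncomputable section

abbrev Rr (n : ℕ) := MvPolynomial (Fin n) ℤ

/-- The "opposite" vertex: 0-indexed version of i ↦ 2n+1−i. -/
def bar {n : ℕ} (i : Fin (2*n)) : Fin (2*n) :=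
  ⟨2*n - 1 - i.val, by have := i.isLt; omega⟩

/-- The weight α_i (0-indexed): α_i = X i for i < n, and α_i = −α_{bar i} otherwise. -/
def av {n : ℕ} (i : Fin (2*n)) : Rr n :=
  if h : i.val < n then X ⟨i.val, h⟩
  else - X ⟨2*n - 1 - i.val, by have := i.isLt; omega⟩

/-- The axial function α(ij). -/
def ax {n : ℕ} (i j : Fin (2*n)) : Rr n :=
  if j = bar i then - av i else - av i + av j

/-- The class M_v. -/
def Mv {n : ℕ} (v : Fin (2*n)) : Fin (2*n) → Rr n := fun j =>
  if j = v then 0 else if j = bar v then 2 * av v else - av j + av v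

/-- The class Q. -/
def Qf {n : ℕ} : Fin (2*n) → Rr n := fun j => - av j

/-- Independence: K contains no pair {i, bar i}. -/
def indep {n : ℕ} (K : Finset (Fin (2*n))) : Prop :=
  ∀ i : Fin (2*n), ¬ ({i, bar i} : Finset (Fin (2*n))) ⊆ K

/-- The class Δ_K. -/
def Del {n : ℕ} (K : Finset (Fin (2*n))) : Fin (2*n) → Rr n := fun j =>
  if j ∈ K then ∏ k ∈ Kᶜ, ax j k else 0

/-- The class Δ'_K. -/
def Del' {n : ℕ} (K : Finset (Fin (2*n))) : Fin (2*n) → Rr n := fun j =>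
  if j ∈ K then ∏ k ∈ (K ∪ {bar j})ᶜ, ax j k else 0

/-- The graph equivariant cohomology H*(GQ_{2n−1}) as a subring of the ring of
functions V → R with pointwise operations. -/
def HGQ (n : ℕ) : Subring (Fin (2*n) → Rr n) where
  carrier := {f | ∀ i j : Fin (2*n), i ≠ j → ax i j ∣ f i - f j}
  zero_mem' := fun i j _ => by simp
  one_mem' := fun i j _ => by simp
  add_mem' := by
    intro a b ha hb i j h
    have e : (a + b) i - (a + b) j = (a i - a j) + (b i - b j) := by
      simp only [Pi.add_apply]; ring
    rw [e]; exact dvd_add (ha i j h) (hb i j h)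
  neg_mem' := by
    intro a ha i j h
    have e : (-a) i - (-a) j = -(a i - a j) := by
      simp only [Pi.neg_apply]; ring
    rw [e]; exact dvd_neg.mpr (ha i j h)
  mul_mem' := by
    intro a b ha hb i j h
    have e : (a * b) i - (a * b) j = a i * (b i - b j) + (a i - a j) * b j := by
      simp only [Pi.mul_apply]; ring
    rw [e]; exact dvd_add ((hb i j h).mul_left _) ((ha i j h).mul_right _)

/-- The graph equivariant cohomology H*(GQ_{2n−2}) (edges i j with j ≠ bar i only). -/
def HGQe (n : ℕ) : Subring (Fin (2*n) → Rr n) where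
  carrier := {f | ∀ i j : Fin (2*n), i ≠ j → j ≠ bar i → ax i j ∣ f i - f j}
  zero_mem' := fun i j _ _ => by simp
  one_mem' := fun i j _ _ => by simp
  add_mem' := by
    intro a b ha hb i j h h'
    have e : (a + b) i - (a + b) j = (a i - a j) + (b i - b j) := by
      simp only [Pi.add_apply]; ring
    rw [e]; exact dvd_add (ha i j h h') (hb i j h h')
  neg_mem' := by
    intro a ha i j h h'
    have e : (-a) i - (-a) j = -(a i - a j) := by
      simp only [Pi.neg_apply]; ring
    rw [e]; exact dvd_neg.mpr (ha i j h h')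
  mul_mem' := by
    intro a b ha hb i j h h'
    have e : (a * b) i - (a * b) j = a i * (b i - b j) + (a i - a j) * b j := by
      simp only [Pi.mul_apply]; ring
    rw [e]; exact dvd_add ((hb i j h h').mul_left _) ((ha i j h h').mul_right _)


/-- The ideal 𝒥 of H*(GQ_{2n−1}) generated by the elements M_i − Q for 1 ≤ i ≤ n. -/
def Jideal (n : ℕ) : Ideal (HGQ n) :=
  Ideal.span {g : HGQ n | ∃ i : Fin (2*n), i.val < n ∧
    (g : Fin (2*n) → Rr n) = Mv i - Qf}

lemma bar_bar {n : ℕ} (i : Fin (2*n)) : bar (bar i) = i := by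
  ext; simp only [bar]; have := i.isLt; omega

lemma bar_ne {n : ℕ} (i : Fin (2*n)) : bar i ≠ i := by
  intro h; have := congrArg Fin.val h; simp only [bar] at this; have := i.isLt; omega

lemma bar_injective {n : ℕ} : Function.Injective (bar : Fin (2*n) → Fin (2*n)) :=
  Function.LeftInverse.injective bar_bar

lemma av_bar {n : ℕ} (i : Fin (2*n)) : av (bar i) = - av i := by
  have hi := i.isLt
  by_cases h : i.val < n
  · have h' : ¬ (bar i).val < n := by simp only [bar]; omega
    have e : (⟨2*n - 1 - (bar i).val, by omega⟩ : Fin n) = ⟨i.val, h⟩ := by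
      ext; simp only [bar]; omega
    rw [av, av, dif_neg h', dif_pos h, e]
  · have h' : (bar i).val < n := by simp only [bar]; omega
    rw [av, av, dif_pos h', dif_neg h, neg_neg]
    rfl

lemma indep_iff {n : ℕ} {K : Finset (Fin (2*n))} : indep K ↔ ∀ i ∈ K, bar i ∉ K := by
  simp [indep, Finset.insert_subset_iff]

lemma ax_bar_right {n : ℕ} (j k : Fin (2*n)) :
    ax j (bar k) = if k = j then - av j else - av j - av k := by
  simp only [ax, bar_injective.eq_iff, av_bar, sub_eq_add_neg]

lemma Mv_sub_Qf {n : ℕ} (v : Fin (2*n)) : Mv v - Qf = Function.const _ (av v) := by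
  funext j
  simp only [Mv, Qf, Pi.sub_apply, Function.const_apply]
  split_ifs with h h'
  · rw [h]; ring
  · rw [h', av_bar]; ring
  · ring

lemma Qf_mem {n : ℕ} : (Qf : Fin (2*n) → Rr n) ∈ HGQ n := by
  intro i j _
  simp only [Qf, ax]
  split_ifs with h
  · rw [h, av_bar]; exact ⟨2, by ring⟩
  · exact ⟨1, by ring⟩

lemma const_mem {n : ℕ} (r : Rr n) : Function.const _ r ∈ HGQ n := by
  intro i j _; simp

lemma compl_eq_image_bar {n : ℕ} {K : Finset (Fin (2*n))} (hK : indep K) (hc : K.card = n) :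
    Kᶜ = K.image bar := by
  symm
  apply Finset.eq_of_subset_of_card_le
  · intro x hx
    obtain ⟨y, hy, rfl⟩ := Finset.mem_image.1 hx
    exact Finset.mem_compl.2 (indep_iff.1 hK y hy)
  · rw [Finset.card_compl, Finset.card_image_of_injective _ bar_injective, Fintype.card_fin]
    omega

lemma bar_mem_of_notMem {n : ℕ} {K : Finset (Fin (2*n))} (hK : indep K) (hc : K.card = n)
    {i : Fin (2*n)} (hi : i ∉ K) : bar i ∈ K := by
  have h := Finset.mem_compl.2 hi
  rw [compl_eq_image_bar hK hc] at h
  obtain ⟨y, hy, rfl⟩ := Finset.mem_image.1 h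
  rwa [bar_bar]

lemma Del_apply_of_card_eq {n : ℕ} {K : Finset (Fin (2*n))} (hK : indep K) (hc : K.card = n)
    {j : Fin (2*n)} (hj : j ∈ K) : Del K j = ∏ k ∈ K, ax j (bar k) := by
  rw [Del, if_pos hj, compl_eq_image_bar hK hc, Finset.prod_image bar_injective.injOn]

/-- `Δ_K` is a class in `H*(GQ_{2n−1})` for every independent `K`. -/
lemma Del_mem {n : ℕ} {K : Finset (Fin (2*n))} (hK : indep K) : Del K ∈ HGQ n := by
  intro i j hij
  by_cases hi : i ∈ K <;> by_cases hj : j ∈ K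
  · have hbi : bar i ∈ Kᶜ := Finset.mem_compl.2 (indep_iff.1 hK i hi)
    have hbj : bar j ∈ Kᶜ := Finset.mem_compl.2 (indep_iff.1 hK j hj)
    have hji : j ≠ bar i := fun h => indep_iff.1 hK i hi (h ▸ hj)
    have hb : bar j ∈ Kᶜ.erase (bar i) :=
      Finset.mem_erase.2 ⟨fun h => hij (bar_injective h).symm, hbj⟩
    rw [Del, Del, if_pos hi, if_pos hj, ← Finset.mul_prod_erase _ _ hbi,
      ← Finset.mul_prod_erase _ _ hb, ← Finset.mul_prod_erase (a := bar i) _ (ax j) hbi,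
      ← Finset.mul_prod_erase _ (ax j) hb, ← Ideal.mem_span_singleton,
      ← Ideal.Quotient.eq]
    have hx : Ideal.Quotient.mk (Ideal.span {ax i j}) (av i)
        = Ideal.Quotient.mk (Ideal.span {ax i j}) (av j) := by
      rw [Ideal.Quotient.eq, Ideal.mem_span_singleton, ax, if_neg hji]
      exact ⟨-1, by ring⟩
    have hp : ∀ k ∈ (Kᶜ.erase (bar i)).erase (bar j),
        Ideal.Quotient.mk (Ideal.span {ax i j}) (ax i k)
          = Ideal.Quotient.mk (Ideal.span {ax i j}) (ax j k) := by
      intro k hk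
      simp only [Finset.mem_erase] at hk
      have h₁ : ax i k = - av i + av k := if_neg hk.2.1
      have h₂ : ax j k = - av j + av k := if_neg hk.1
      rw [h₁, h₂, map_add, map_add, map_neg, map_neg, hx]
    rw [map_mul, map_mul, map_mul, map_mul, map_prod, map_prod, Finset.prod_congr rfl hp]
    simp only [ax_bar_right, if_neg hij, if_neg hij.symm, if_true, map_neg, map_sub, hx]
    ring
  · rw [Del, Del, if_pos hi, if_neg hj, sub_zero]
    exact Finset.dvd_prod_of_mem _ (Finset.mem_compl.2 hj)
  · rw [Del, Del, if_neg hi, if_pos hj, zero_sub, dvd_neg]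
    refine dvd_trans ?_ (Finset.dvd_prod_of_mem _ (Finset.mem_compl.2 hi))
    by_cases h : j = bar i
    · subst h
      simp [ax, bar_bar, av_bar]
    · have h' : i ≠ bar j := fun e => h (by rw [e, bar_bar])
      rw [ax, ax, if_neg h, if_neg h']
      exact ⟨-1, by ring⟩
  · rw [Del, Del, if_neg hi, if_neg hj, sub_zero]
    exact dvd_zero _

lemma indep_insert {n : ℕ} {S : Finset (Fin (2*n))} (hS : indep S) {v : Fin (2*n)}
    (hv : bar v ∉ S) : indep (insert v S) := by
  rw [indep_iff] at hS ⊢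
  intro i hi h
  rcases Finset.mem_insert.1 hi with rfl | hi <;> rcases Finset.mem_insert.1 h with h | h
  · exact bar_ne _ h
  · exact hv h
  · rw [← h, bar_bar] at hv; exact hv hi
  · exact hS i hi h

lemma indep.mono {n : ℕ} {S K : Finset (Fin (2*n))} (hK : indep K) (h : S ⊆ K) : indep S :=
  fun i hi => hK i (hi.trans h)

/-- Replacing one vertex of a maximal independent set by its opposite changes `Δ` by
a multiple of the weight of that vertex. -/
lemma Del_insert_sub_Del_insert_bar {n : ℕ} {S : Finset (Fin (2*n))} (hS : indep S)
    (hc : S.card + 1 = n) {v : Fin (2*n)} (hv : v ∉ S) (hbv : bar v ∉ S) :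
    Del (insert v S) - Del (insert (bar v) S) =
      Function.const _ (- av v) * ∏ k ∈ S, (Qf - Function.const _ (av k)) := by
  have hK := indep_insert hS hbv
  have hK' : indep (insert (bar v) S) := indep_insert hS (by rwa [bar_bar])
  have hKc : (insert v S).card = n := by rw [Finset.card_insert_of_notMem hv, hc]
  have hKc' : (insert (bar v) S).card = n := by rw [Finset.card_insert_of_notMem hbv, hc]
  have hprod : ∀ j, j ∉ S → ∏ k ∈ S, ax j (bar k) = ∏ k ∈ S, (- av j - av k) := by
    intro j hj
    refine Finset.prod_congr rfl fun k hk => ?_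
    rw [ax_bar_right, if_neg (ne_of_mem_of_not_mem hk hj)]
  funext j
  simp only [Pi.sub_apply, Pi.mul_apply, Finset.prod_apply, Function.const_apply, Qf]
  by_cases hjS : j ∈ S
  · have hjv : v ≠ j := fun h => hv (h ▸ hjS)
    have hjbv : bar v ≠ j := fun h => hbv (h ▸ hjS)
    have hrest : ∏ k ∈ S.erase j, ax j (bar k) = ∏ k ∈ S.erase j, (- av j - av k) := by
      refine Finset.prod_congr rfl fun k hk => ?_
      rw [ax_bar_right, if_neg (Finset.ne_of_mem_erase hk)]
    rw [Del_apply_of_card_eq hK hKc (Finset.mem_insert_of_mem hjS),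
      Del_apply_of_card_eq hK' hKc' (Finset.mem_insert_of_mem hjS),
      Finset.prod_insert hv, Finset.prod_insert hbv,
      ← Finset.mul_prod_erase _ (fun k => ax j (bar k)) hjS,
      ← Finset.mul_prod_erase _ (fun k => - av j - av k) hjS, hrest,
      ax_bar_right j v, ax_bar_right j (bar v), ax_bar_right j j,
      if_neg hjv, if_neg hjbv, if_pos rfl, av_bar]
    ring
  by_cases hjv : j = v
  · subst hjv
    have h : j ∉ insert (bar j) S := by
      simp [hv, (bar_ne j).symm]
    rw [Del_apply_of_card_eq hK hKc (Finset.mem_insert_self _ _), Del, if_neg h,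
      Finset.prod_insert hv, hprod j hv, ax_bar_right, if_pos rfl, sub_zero]
  by_cases hjbv : j = bar v
  · subst hjbv
    have h : bar v ∉ insert v S := by
      simp [hbv, bar_ne v]
    rw [Del_apply_of_card_eq hK' hKc' (Finset.mem_insert_self _ _), Del, if_neg h,
      Finset.prod_insert hbv, hprod _ hbv, ax_bar_right, if_pos rfl, av_bar]
    ring
  · have hj : j ∉ insert v S := by simp [hjv, hjS]
    have hj' : j ∉ insert (bar v) S := by simp [hjbv, hjS]
    have hbj : bar j ∈ S := by
      refine Finset.mem_of_mem_insert_of_ne (bar_mem_of_notMem hK hKc hj) fun h => hjbv ?_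
      rw [← h, bar_bar]
    rw [Del, Del, if_neg hj, if_neg hj', Finset.prod_eq_zero hbj (by rw [av_bar]; ring)]
    ring

/-- Enlarging an independent set by a vertex `v` divides `Δ` by `M_v = Q + α_v`. -/
lemma Del_eq_mul_Del_insert {n : ℕ} {S : Finset (Fin (2*n))} {v : Fin (2*n)} (hv : v ∉ S)
    (hbv : bar v ∉ S) : Del S = (Qf + Function.const _ (av v)) * Del (insert v S) := by
  funext j
  simp only [Pi.add_apply, Pi.mul_apply, Function.const_apply, Qf, Del]
  by_cases hj : j ∈ S
  · have h : v ≠ bar j := fun e => hbv (by rwa [e, bar_bar])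
    rw [if_pos hj, if_pos (Finset.mem_insert_of_mem hj), Finset.compl_insert,
      ← Finset.mul_prod_erase _ _ (Finset.mem_compl.2 hv)]
    simp only [ax, if_neg h]
  · by_cases hjv : j = v
    · subst hjv; rw [if_neg hj]; ring
    · rw [if_neg hj, if_neg (by simp [hj, hjv])]; ring

lemma const_av_mem_Jideal {n : ℕ} (v : Fin (2*n)) :
    (⟨Function.const _ (av v), const_mem _⟩ : HGQ n) ∈ Jideal n := by
  have key : ∀ v : Fin (2*n), v.val < n →
      (⟨Function.const _ (av v), const_mem _⟩ : HGQ n) ∈ Jideal n := fun v hv =>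
    Ideal.subset_span ⟨v, hv, (Mv_sub_Qf v).symm⟩
  by_cases hv : v.val < n
  · exact key v hv
  · have hb : (bar v).val < n := by simp only [bar]; have := v.isLt; omega
    have h := (Jideal n).neg_mem (key _ hb)
    convert h using 1
    ext1
    funext j
    simp [av_bar]

/-- The difference of the `Δ` classes of two maximal independent sets lies in `𝒥`. -/
lemma Del_sub_Del_mem_Jideal {n : ℕ} {H : Finset (Fin (2*n))} (hH : indep H)
    (hHc : H.card = n) {K : Finset (Fin (2*n))} (hK : indep K) (hKc : K.card = n) :
    (⟨Del K, Del_mem hK⟩ - ⟨Del H, Del_mem hH⟩ : HGQ n) ∈ Jideal n := by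
  induction hm : (K \ H).card using Nat.strong_induction_on generalizing K with
  | _ m ih =>
    by_cases hKH : K ⊆ H
    · obtain rfl := Finset.eq_of_subset_of_card_le hKH (by omega)
      rw [sub_self]
      exact zero_mem _
    obtain ⟨v, hvK, hvH⟩ := Finset.not_subset.1 hKH
    have hbH := bar_mem_of_notMem hH hHc hvH
    have hbK := indep_iff.1 hK v hvK
    obtain ⟨S, hvS, rfl⟩ : ∃ S, v ∉ S ∧ insert v S = K :=
      ⟨K.erase v, Finset.notMem_erase _ _, Finset.insert_erase hvK⟩
    have hbS : bar v ∉ S := fun h => hbK (Finset.mem_insert_of_mem h)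
    have hS := hK.mono (Finset.subset_insert v S)
    have hSc : S.card + 1 = n := (Finset.card_insert_of_notMem hvS).symm.trans hKc
    have hK' : indep (insert (bar v) S) := indep_insert hS (by rwa [bar_bar])
    have hlt : (insert (bar v) S \ H).card < m := by
      rw [← hm, Finset.insert_sdiff_of_mem _ hbH, Finset.insert_sdiff_of_notMem _ hvH,
        Finset.card_insert_of_notMem (by simp [hvS])]
      omega
    have h₁ := ih _ hlt hK' (by rw [Finset.card_insert_of_notMem hbS, hSc]) rfl
    have h₂ : (⟨Del (insert v S), Del_mem hK⟩ - ⟨Del (insert (bar v) S), Del_mem hK'⟩ : HGQ n)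
        ∈ Jideal n := by
      have hG : ∏ k ∈ S, (Qf - Function.const _ (av k)) ∈ HGQ n :=
        Subring.prod_mem _ fun k _ => Subring.sub_mem _ Qf_mem (const_mem _)
      convert (Jideal n).mul_mem_left ⟨_, hG⟩ ((Jideal n).neg_mem (const_av_mem_Jideal v)) using 1
      ext1
      refine (Del_insert_sub_Del_insert_bar hS hSc hvS hbS).trans ?_
      refine (mul_comm (Function.const _ (- av v)) _).trans ?_
      rfl
    have h := add_mem h₂ h₁
    rwa [sub_add_sub_cancel] at h

lemma exists_notMem_and_bar_notMem {n : ℕ} {L : Finset (Fin (2*n))} (hL : L.card < n) :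
    ∃ v, v ∉ L ∧ bar v ∉ L := by
  have hc : (L ∪ L.image bar).card < Fintype.card (Fin (2*n)) := by
    have h₁ := Finset.card_union_le L (L.image bar)
    have h₂ := Finset.card_image_le (s := L) (f := bar)
    rw [Fintype.card_fin]
    omega
  obtain ⟨v, hv⟩ : ∃ v, v ∉ L ∪ L.image bar := by
    by_contra! h
    rw [Finset.eq_univ_of_forall h, Finset.card_univ] at hc
    exact hc.false
  refine ⟨v, fun h => hv (Finset.mem_union_left _ h), fun h => hv (Finset.mem_union_right _ ?_)⟩
  exact Finset.mem_image.2 ⟨_, h, bar_bar v⟩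

/-- `Δ_L` is congruent to `Δ_K Q^l` modulo `𝒥` when `K` is maximal independent and
`L` is independent of cardinality `n - l`. -/
lemma Del_sub_Del_mul_Qf_pow_mem_Jideal {n : ℕ} {K : Finset (Fin (2*n))} (hK : indep K)
    (hKc : K.card = n) (l : ℕ) {L : Finset (Fin (2*n))} (hL : indep L) (hLc : L.card + l = n) :
    (⟨Del L, Del_mem hL⟩ - ⟨Del K, Del_mem hK⟩ * ⟨Qf, Qf_mem⟩ ^ l : HGQ n) ∈ Jideal n := by
  induction l generalizing L with
  | zero =>
    rw [pow_zero, mul_one]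
    exact Del_sub_Del_mem_Jideal hK hKc hL hLc
  | succ l ih =>
    obtain ⟨v, hv, hbv⟩ := exists_notMem_and_bar_notMem (L := L) (by omega)
    have hL' := indep_insert hL hbv
    have h₁ := ih hL' (by rw [Finset.card_insert_of_notMem hv]; omega)
    have e : (⟨Del L, Del_mem hL⟩ : HGQ n) =
        (⟨Qf, Qf_mem⟩ + ⟨Function.const _ (av v), const_mem _⟩) *
          ⟨Del (insert v L), Del_mem hL'⟩ :=
      Subtype.ext (Del_eq_mul_Del_insert hv hbv)
    have h₂ := add_mem ((Jideal n).mul_mem_left ⟨Qf, Qf_mem⟩ h₁)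
      ((Jideal n).mul_mem_left ⟨Del (insert v L), Del_mem hL'⟩ (const_av_mem_Jideal v))
    rw [e]
    convert h₂ using 1
    ring

/-- (a) if K, H are independent with |K| = |H| = n, then Δ_K − Δ_H ∈ 𝒥;
(b) if moreover L is nonempty independent with |L| = n − l, 1 ≤ l ≤ n−1, then
Δ_L − Δ_K·Q^l ∈ 𝒥. -/
theorem stmt14 (n : ℕ) (hn : 1 ≤ n) :
    (∀ K H : Finset (Fin (2*n)), indep K → indep H → K.card = n → H.card = n →
      ∀ g : HGQ n, (g : Fin (2*n) → Rr n) = Del K - Del H → g ∈ Jideal n) ∧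
    (∀ K : Finset (Fin (2*n)), indep K → K.card = n →
      ∀ (L : Finset (Fin (2*n))) (l : ℕ), L.Nonempty → indep L →
        1 ≤ l → l ≤ n - 1 → L.card = n - l →
        ∀ g : HGQ n, (g : Fin (2*n) → Rr n) = Del L - Del K * Qf ^ l → g ∈ Jideal n) := by
  constructor
  · intro K H hK hH hKc hHc g hg
    obtain rfl : g = ⟨Del K, Del_mem hK⟩ - ⟨Del H, Del_mem hH⟩ := Subtype.ext hg
    exact Del_sub_Del_mem_Jideal hH hHc hK hKc
  · intro K hK hKc L l _ hL _ hl hLc g hg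
    obtain rfl : g = ⟨Del L, Del_mem hL⟩ - ⟨Del K, Del_mem hK⟩ * ⟨Qf, Qf_mem⟩ ^ l :=
      Subtype.ext hg
    exact Del_sub_Del_mul_Qf_pow_mem_Jideal hK hKc l hL (by omega)

end
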